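/- arXiv:2308.14354 — 2 statements merged into one kernel-verified Lean document; each statement's English description precedes it below -/
import Mathlib

section
/- Let b ≥ 2 be a natural number, let q be a prime with q ∤ b, and let k be a natural number with 0 ≤ k ≤ q−1. Suppose x is a natural number with gcd(x, q(q−1)) = 1 and b^x ≡ kx + b (mod q). Then for every prime p with p ≡ x (mod q(q−1)), one has b^{qp} ≡ b^q + kp (mod qp). -/
theorem ZMod.pow_eq_pow_of_modEq_sub_one {q : ℕ} [Fact q.Prime] {a : ZMod q} (ha : a ≠ 0)
    {m n : ℕ} (h : m ≡ n [MOD q - 1]) : a ^ m = a ^ n := by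
  have hu : (Units.mk0 a ha) ^ m = (Units.mk0 a ha) ^ n :=
    pow_eq_pow_iff_modEq.2
      (h.of_dvd (orderOf_dvd_of_pow_eq_one (ZMod.units_pow_card_sub_one_eq_one q _)))
  simpa using congrArg Units.val hu

theorem stmt_7 (b q k x : ℕ) (hb : 2 ≤ b) (hq : q.Prime) (hnd : ¬ q ∣ b)
    (hk : k ≤ q - 1) (hx : Nat.gcd x (q * (q - 1)) = 1)
    (hsol : b ^ x ≡ k * x + b [MOD q]) :
    ∀ p : ℕ, p.Prime → p ≡ x [MOD q * (q - 1)] →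
      (b : ℤ) ^ (q * p) ≡ (b : ℤ) ^ q + (k : ℤ) * (p : ℤ) [ZMOD (q : ℤ) * (p : ℤ)] := by
  intro p hp hpx
  have := Fact.mk hp
  have := Fact.mk hq
  have hpxq : p ≡ x [MOD q] := hpx.of_dvd (Dvd.intro _ rfl)
  have hpxq' : p ≡ x [MOD q - 1] := hpx.of_dvd (Dvd.intro_left _ rfl)
  have hne : q ≠ p := by
    rintro rfl
    have hqx : q ∣ x := (hpxq.dvd_iff dvd_rfl).1 dvd_rfl
    exact hq.one_lt.ne' (Nat.dvd_one.1 (hx ▸ Nat.dvd_gcd hqx (Dvd.intro _ rfl)))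
  have hcop : (q : ℤ).natAbs.Coprime (p : ℤ).natAbs := by
    simpa using (Nat.coprime_primes hq hp).2 hne
  refine (Int.modEq_and_modEq_iff_modEq_mul hcop).1 ⟨?_, ?_⟩
  · rw [← ZMod.intCast_eq_intCast_iff]
    have hb0 : (b : ZMod q) ≠ 0 := by rwa [Ne, ZMod.natCast_eq_zero_iff]
    have hs : (b : ZMod q) ^ x = k * x + b := by
      exact_mod_cast (ZMod.natCast_eq_natCast_iff _ _ q).2 hsol
    have hc : (p : ZMod q) = x := (ZMod.natCast_eq_natCast_iff _ _ q).2 hpxq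
    push_cast
    rw [pow_mul, ZMod.pow_card, ZMod.pow_eq_pow_of_modEq_sub_one hb0 hpxq', hs, hc, add_comm]
  · rw [← ZMod.intCast_eq_intCast_iff]
    push_cast
    rw [pow_mul, ZMod.pow_card, ZMod.natCast_self, mul_zero, add_zero]
end

section
/- Let b ≥ 2 be a natural number and let q be a prime with q ∤ b and b² ≢ 1 (mod q). Define S_{b,q} = { (b^{qp} mod qp)/(qp) : p prime } as a subset of ℝ. Then the set of limit points of S_{b,q} in ℝ is exactly { k/q : k = 0, 1, 2, …, q−1 }. -/
open Filter Topology

/-- For a prime `p` exceeding `b ^ q`, the residue of `b ^ (q * p)` modulo `q * p` is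
`b ^ q + k * p`, where `k < q` is determined modulo `q` by `b + p * k = b ^ p`. -/
theorem exists_pow_mul_mod_eq {b q p : ℕ} [Fact q.Prime] (hp : p.Prime) (hlt : b ^ q < p) :
    ∃ k < q, b ^ (q * p) % (q * p) = b ^ q + p * k ∧
      ((b : ZMod q) + p * k = (b : ZMod q) ^ p) := by
  have := Fact.mk hp
  have hq : 0 < q := (Fact.out : q.Prime).pos
  have hmod : b ^ (q * p) % (q * p) % p = b ^ q := by
    rw [Nat.mod_mod_of_dvd _ (dvd_mul_left p q), ← Nat.mod_eq_of_lt hlt]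
    change _ ≡ _ [MOD p]
    rw [← ZMod.natCast_eq_natCast_iff]
    simp [pow_mul, ZMod.pow_card]
  have hdecomp := Nat.mod_add_div (b ^ (q * p) % (q * p)) p
  rw [hmod] at hdecomp
  refine ⟨b ^ (q * p) % (q * p) / p, ?_, hdecomp.symm, ?_⟩
  · exact (Nat.div_lt_iff_lt_mul hp.pos).2 (Nat.mod_lt _ (Nat.mul_pos hq hp.pos))
  · have hcast : ((b ^ (q * p) % (q * p) : ℕ) : ZMod q) = (b : ZMod q) ^ p := by
      rw [← ZMod.natCast_mod, Nat.mod_mod_of_dvd _ (dvd_mul_right q p), ZMod.natCast_mod]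
      simp [pow_mul, ZMod.pow_card]
    rw [← hcast]
    conv_rhs => rw [← hdecomp]
    simp [ZMod.pow_card]

/-- Dirichlet's theorem for two coprime moduli `m` and `n`, with a prescribed coprime residue modulo
each of them. -/
theorem exists_prime_gt_modEq_and_modEq {m n c d : ℕ} (hmn : m.Coprime n) (hm : m ≠ 0)
    (hn : n ≠ 0) (hc : c.Coprime m) (hd : d.Coprime n) (N : ℕ) :
    ∃ p > N, p.Prime ∧ p ≡ c [MOD m] ∧ p ≡ d [MOD n] := by
  obtain ⟨a, hac, had⟩ := Nat.chineseRemainder hmn c d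
  have ha : a.Coprime (m * n) := by
    refine Nat.Coprime.mul_right ?_ ?_
    · rw [Nat.Coprime, hac.gcd_eq]; exact hc
    · rw [Nat.Coprime, had.gcd_eq]; exact hd
  obtain ⟨p, hpN, hp, hpa⟩ :=
    Nat.forall_exists_prime_gt_and_modEq N (Nat.mul_ne_zero hm hn) ha
  exact ⟨p, hpN, hp, (hpa.of_mul_right _).trans hac, (hpa.of_mul_left _).trans had⟩

/-- If `b` is a unit modulo the prime `q` with `b ^ 2 ≠ 1`, then `b + p * k = b ^ p` holds modulo `q`
for arbitrarily large primes `p`. -/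
theorem exists_prime_gt_add_mul_eq_pow {q : ℕ} [Fact q.Prime] {b : ZMod q} (hb0 : b ≠ 0)
    (hb2 : b ^ 2 ≠ 1) (k : ZMod q) (N : ℕ) :
    ∃ p > N, p.Prime ∧ b + p * k = b ^ p := by
  have hq : q.Prime := Fact.out
  have hq2 : 2 ≤ q := hq.two_le
  have hq3 : 3 ≤ q := by
    rcases hq2.lt_or_eq with h | rfl
    · exact h
    · have h1 : b ^ (2 - 1) = 1 := ZMod.pow_card_sub_one_eq_one hb0
      exact absurd (by rw [show b = 1 by simpa using h1, one_pow]) hb2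
  have hcop : q.Coprime (q - 1) := by
    have : (q - 1 + 1).Coprime (q - 1) := by simp
    rwa [Nat.sub_add_cancel (by omega)] at this
  have hpow {p d : ℕ} (h : p ≡ d [MOD q - 1]) : b ^ p = b ^ d :=
    pow_eq_pow_of_modEq h (ZMod.pow_card_sub_one_eq_one hb0)
  by_cases hk : k = 0
  · obtain ⟨p, hpN, hp, -, hpd⟩ := exists_prime_gt_modEq_and_modEq hcop (by omega) (by omega)
      (Nat.coprime_one_left q) (Nat.coprime_one_left (q - 1)) N
    exact ⟨p, hpN, hp, by simp [hpow hpd, hk]⟩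
  · have hinv : b ^ (q - 2) = b⁻¹ := by
      apply eq_inv_of_mul_eq_one_left
      rw [← pow_succ, show q - 2 + 1 = q - 1 by omega, ZMod.pow_card_sub_one_eq_one hb0]
    have hne : b⁻¹ - b ≠ 0 := by
      intro h
      apply hb2
      rw [sub_eq_zero] at h
      rw [pow_two]
      nth_rewrite 1 [← h]
      exact inv_mul_cancel₀ hb0
    set c : ZMod q := (b⁻¹ - b) / k with hc
    have hcc : c.val.Coprime q := by
      rw [Nat.coprime_comm, hq.coprime_iff_not_dvd, ← ZMod.natCast_eq_zero_iff,
        ZMod.natCast_zmod_val]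
      exact div_ne_zero hne hk
    have hdd : (q - 2).Coprime (q - 1) := by
      have : (q - 2).Coprime (q - 2 + 1) := by simp
      rwa [show q - 2 + 1 = q - 1 by omega] at this
    obtain ⟨p, hpN, hp, hpc, hpd⟩ :=
      exists_prime_gt_modEq_and_modEq hcop (by omega) (by omega) hcc hdd N
    refine ⟨p, hpN, hp, ?_⟩
    rw [hpow hpd, hinv, (ZMod.natCast_eq_natCast_iff _ _ _).2 hpc, ZMod.natCast_zmod_val, hc,
      div_mul_cancel₀ _ hk]
    ring

/-- Every neighborhood of an accumulation point of the values of a sequence on a set of indices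
contains such values with arbitrarily large index. -/
theorem AccPt.exists_gt_mem {X : Type*} [TopologicalSpace X] [T1Space X] {P : ℕ → Prop}
    {f : ℕ → X} {x : X} (h : AccPt x (𝓟 {r | ∃ n, P n ∧ r = f n})) {s : Set X} (hs : s ∈ 𝓝 x)
    (N : ℕ) : ∃ n > N, P n ∧ f n ∈ s := by
  have hfin : ((f '' Set.Iic N) \ {x}).Finite := ((Set.finite_Iic N).image f).subset Set.sdiff_subset
  have hmem : ((f '' Set.Iic N) \ {x})ᶜ ∈ 𝓝 x := hfin.isClosed.isOpen_compl.mem_nhds (by simp)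
  obtain ⟨y, ⟨⟨hys, hy⟩, n, hn, rfl⟩, hyx⟩ := accPt_iff_nhds.1 h _ (inter_mem hs hmem)
  refine ⟨n, ?_, hn, hys⟩
  by_contra! hle
  exact hy ⟨⟨n, hle, rfl⟩, hyx⟩

theorem stmt_11 (b q : ℕ) (hb : 2 ≤ b) (hq : q.Prime) (hnd : ¬ q ∣ b)
    (hb2 : ¬ b ^ 2 ≡ 1 [MOD q]) :
    {x : ℝ | AccPt x (𝓟 {r : ℝ | ∃ p : ℕ, p.Prime ∧
        r = ((b ^ (q * p) % (q * p) : ℕ) : ℝ) / ((q * p : ℕ) : ℝ)})} =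
      {x : ℝ | ∃ k : ℕ, k < q ∧ x = (k : ℝ) / (q : ℝ)} := by
  have := Fact.mk hq
  have hq0 : (0 : ℝ) < q := by exact_mod_cast hq.pos
  have hb0 : (0 : ℝ) < b := by exact_mod_cast (by omega : 0 < b)
  have hval {p k : ℕ} (hp : p.Prime) (h : b ^ (q * p) % (q * p) = b ^ q + p * k) :
      ((b ^ (q * p) % (q * p) : ℕ) : ℝ) / ((q * p : ℕ) : ℝ) = k / q + (b : ℝ) ^ q / q / p := by
    have hp0 : (p : ℝ) ≠ 0 := by exact_mod_cast hp.ne_zero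
    rw [h]
    push_cast
    field_simp
    ring
  have hlim : Tendsto (fun p : ℕ ↦ (b : ℝ) ^ q / q / p) atTop (𝓝 0) :=
    tendsto_const_div_atTop_nhds_zero_nat _
  ext x
  simp only [Set.mem_ofPred_eq]
  constructor
  · intro hx
    have hfin : {y : ℝ | ∃ k : ℕ, k < q ∧ y = (k : ℝ) / (q : ℝ)}.Finite := by
      refine ((Set.finite_Iio q).image fun k : ℕ ↦ (k : ℝ) / q).subset ?_
      rintro _ ⟨k, hk, rfl⟩
      exact ⟨k, hk, rfl⟩
    change x ∈ {y : ℝ | ∃ k : ℕ, k < q ∧ y = (k : ℝ) / (q : ℝ)}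
    rw [← hfin.isClosed.closure_eq, Metric.mem_closure_iff]
    intro ε hε
    obtain ⟨N, hN⟩ := eventually_atTop.1 (hlim.eventually_lt_const (half_pos hε))
    obtain ⟨p, hpN, hp, hball⟩ :=
      AccPt.exists_gt_mem hx (Metric.ball_mem_nhds x (half_pos hε)) (max N (b ^ q))
    obtain ⟨k, hk, hr, -⟩ := exists_pow_mul_mod_eq hp ((le_max_right _ _).trans_lt hpN)
    refine ⟨k / q, ⟨k, hk, rfl⟩, ?_⟩
    have hNp := hN p ((le_max_left _ _).trans hpN.le)
    have hnn : 0 ≤ (b : ℝ) ^ q / q / p := by positivity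
    rw [hval hp hr, Metric.mem_ball, Real.dist_eq, abs_lt] at hball
    rw [Real.dist_eq, abs_lt]
    constructor <;> linarith [hball.1, hball.2]
  · rintro ⟨k, hk, rfl⟩
    rw [accPt_iff_nhds]
    intro u hu
    obtain ⟨ε, hε, hεu⟩ := Metric.mem_nhds_iff.1 hu
    obtain ⟨N, hN⟩ := eventually_atTop.1 (hlim.eventually_lt_const hε)
    obtain ⟨p, hpN, hp, hpk⟩ := exists_prime_gt_add_mul_eq_pow (b := (b : ZMod q))
      (by rwa [Ne, ZMod.natCast_eq_zero_iff])
      (fun h ↦ hb2 ((ZMod.natCast_eq_natCast_iff _ _ _).1 (by simpa using h)))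
      (k : ZMod q) (max N (b ^ q + q))
    have hpbq : b ^ q + q < p := (le_max_right _ _).trans_lt hpN
    obtain ⟨j, hj, hr, hpj⟩ := exists_pow_mul_mod_eq (b := b) (q := q) hp (by omega)
    have hp0 : (p : ZMod q) ≠ 0 := by
      rw [Ne, ZMod.natCast_eq_zero_iff, Nat.prime_dvd_prime_iff_eq hq hp]
      omega
    have hjk : j = k := by
      have h := mul_left_cancel₀ hp0 (add_left_cancel (hpj.trans hpk.symm))
      exact ((ZMod.natCast_eq_natCast_iff _ _ _).1 h).eq_of_lt_of_lt hj hk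
    subst hjk
    have hpos : 0 < (b : ℝ) ^ q / q / p := by
      have : (0 : ℝ) < p := by exact_mod_cast hp.pos
      positivity
    refine ⟨j / q + (b : ℝ) ^ q / q / p, ⟨hεu ?_, p, hp, (hval hp hr).symm⟩, by linarith⟩
    rw [Metric.mem_ball, Real.dist_eq, add_sub_cancel_left, abs_of_pos hpos]
    exact hN p ((le_max_left _ _).trans hpN.le)
end
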